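/- arXiv:2412.17157 — 5 statements merged into one kernel-verified Lean document; each statement's English description precedes it below -/
import Mathlib

section
/- Let p, q be positive natural numbers, let A₁ be a real p×p matrix, A₂ a real p×q matrix, A₃ a real q×p matrix, and D an invertible real q×q matrix. Set G_s = fromBlocks(A₁ + s·I_p, A₂, A₃, D) for s ∈ ℝ. Then, as s → +∞, the inverse matrices G_s⁻¹ converge (entrywise) to the block matrix fromBlocks(0, 0, 0, D⁻¹). -/
open Matrix in
/-- Scaling the first block row by `s⁻¹` exhibits the inverse of
`fromBlocks (A + s • 1) B C D` as a product whose factors depend continuously on `s⁻¹`. -/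
theorem Matrix.inv_fromBlocks_add_smul_one {m n : Type*} [Fintype m] [DecidableEq m]
    [Fintype n] [DecidableEq n] {K : Type*} [Field K]
    (A : Matrix m m K) (B : Matrix m n K) (C : Matrix n m K) (D : Matrix n n K)
    {s : K} (hs : s ≠ 0) :
    (fromBlocks (A + s • 1) B C D)⁻¹ =
      (fromBlocks (1 + s⁻¹ • A) (s⁻¹ • B) C D)⁻¹ *
        fromBlocks (s⁻¹ • (1 : Matrix m m K)) 0 0 (1 : Matrix n n K) := by
  have h : fromBlocks (s⁻¹ • (1 : Matrix m m K)) 0 0 (1 : Matrix n n K) =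
      (fromBlocks (s • (1 : Matrix m m K)) 0 0 (1 : Matrix n n K))⁻¹ := by
    refine (inv_eq_left_inv ?_).symm
    simp [fromBlocks_multiply, smul_smul, hs]
  rw [h, ← mul_inv_rev]
  simp [fromBlocks_multiply, smul_smul, hs, smul_add, add_comm]

open Filter Matrix Topology in
theorem Matrix.tendsto_inv_fromBlocks_add_smul_one {m n : Type*} [Fintype m] [DecidableEq m]
    [Fintype n] [DecidableEq n]
    (A : Matrix m m ℝ) (B : Matrix m n ℝ) (C : Matrix n m ℝ) {D : Matrix n n ℝ}
    (hD : IsUnit D) :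
    Tendsto (fun s : ℝ => (fromBlocks (A + s • 1) B C D)⁻¹) atTop
      (𝓝 (fromBlocks 0 0 0 D⁻¹)) := by
  let M : ℝ → Matrix (m ⊕ n) (m ⊕ n) ℝ := fun t => fromBlocks (1 + t • A) (t • B) C D
  let E : ℝ → Matrix (m ⊕ n) (m ⊕ n) ℝ := fun t => fromBlocks (t • 1) 0 0 1
  have hM : Continuous M := Continuous.matrix_fromBlocks (by fun_prop) (by fun_prop)
    continuous_const continuous_const
  have hE : Continuous E := Continuous.matrix_fromBlocks (by fun_prop) continuous_const
    continuous_const continuous_const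
  have hdet : (M 0).det ≠ 0 := by
    simpa [M] using ((isUnit_iff_isUnit_det D).mp hD).ne_zero
  have hinv : ContinuousAt (fun t => (M t)⁻¹) 0 := by
    simp only [inv_def, Ring.inverse_eq_inv']
    exact (hM.matrix_det.continuousAt.inv₀ hdet).smul hM.matrix_adjugate.continuousAt
  have hlim : (M 0)⁻¹ * E 0 = fromBlocks 0 0 0 D⁻¹ := by
    simp [M, E, inv_fromBlocks_zero₁₂_of_isUnit_iff, hD, fromBlocks_multiply]
  rw [← hlim]
  refine ((hinv.mul hE.continuousAt).tendsto.comp tendsto_inv_atTop_zero).congr' ?_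
  filter_upwards [eventually_ne_atTop 0] with s hs
  exact (inv_fromBlocks_add_smul_one A B C D hs).symm

/-- As `s → +∞`, the inverses of the block matrices
`G_s = fromBlocks (A₁ + s•I) A₂ A₃ D` converge (entrywise, i.e. in the product
topology on matrices) to `fromBlocks 0 0 0 D⁻¹`. -/
theorem fromBlocks_inv_tendsto_atTop
    (p q : ℕ) (hp : 0 < p) (hq : 0 < q)
    (A₁ : Matrix (Fin p) (Fin p) ℝ) (A₂ : Matrix (Fin p) (Fin q) ℝ)
    (A₃ : Matrix (Fin q) (Fin p) ℝ) (D : Matrix (Fin q) (Fin q) ℝ)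
    (hD : IsUnit D) :
    Filter.Tendsto
      (fun s : ℝ =>
        (Matrix.fromBlocks (A₁ + s • (1 : Matrix (Fin p) (Fin p) ℝ)) A₂ A₃ D)⁻¹)
      Filter.atTop
      (nhds (Matrix.fromBlocks (0 : Matrix (Fin p) (Fin p) ℝ)
        (0 : Matrix (Fin p) (Fin q) ℝ) (0 : Matrix (Fin q) (Fin p) ℝ) D⁻¹)) := by
  exact Matrix.tendsto_inv_fromBlocks_add_smul_one A₁ A₂ A₃ hD
end

section
/- Let p, q be positive natural numbers, let K ⊂ ℝ^p × ℝ^q be a compact convex set, let m ∈ ℝ^p be such that (m, y₀) is an interior point of K for some y₀ ∈ ℝ^q, and let f : ℝ^p × ℝ^q → ℝ be continuous. Then lim_{s→+∞} (s/π)^{p/2} ∫_K e^{−s‖x−m‖²} f(x, y) dx dy = ∫_{K_m} f(m, y) dy, where K_m = {y ∈ ℝ^q : (m, y) ∈ K} is the slice of K over m. -/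
open MeasureTheory

open Filter Topology in
/-- Gaussians decay faster than any power of the norm. -/
lemma tendsto_norm_pow_mul_exp_neg_norm_sq_cobounded
    {E : Type*} [NormedAddCommGroup E] (n : ℕ) :
    Tendsto (fun x : E => ‖x‖ ^ n * Real.exp (-‖x‖ ^ 2)) (Bornology.cobounded E) (𝓝 0) := by
  suffices h : Tendsto (fun r : ℝ => r ^ n * Real.exp (-r ^ 2)) atTop (𝓝 0) from
    h.comp tendsto_norm_cobounded_atTop
  refine squeeze_zero' ?_ ?_ (Real.tendsto_pow_mul_exp_neg_atTop_nhds_zero n)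
  · filter_upwards [eventually_ge_atTop 0] with r hr
    positivity
  · filter_upwards [eventually_ge_atTop 1] with r hr
    gcongr
    nlinarith

open Filter Topology in
/-- The rescaled Gaussian is an approximate identity. -/
lemma tendsto_rpow_mul_integral_exp_neg_mul_norm_sq
    {E : Type*} [NormedAddCommGroup E] [InnerProductSpace ℝ E] [FiniteDimensional ℝ E]
    [MeasurableSpace E] [BorelSpace E] {g : E → ℝ} {m : E}
    (hg : Integrable g) (hgm : ContinuousAt g m) :
    Tendsto (fun s : ℝ => (s / Real.pi) ^ ((Module.finrank ℝ E : ℝ) / 2) *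
      ∫ x, Real.exp (-s * ‖x - m‖ ^ 2) * g x) atTop (𝓝 (g m)) := by
  set d := Module.finrank ℝ E with hd
  have hpi : (0 : ℝ) < Real.pi ^ ((d : ℝ) / 2) := by positivity
  have key := tendsto_integral_comp_smul_smul_of_integrable' (μ := volume) (g := g) (x₀ := m)
    (φ := fun x : E => (Real.pi ^ ((d : ℝ) / 2))⁻¹ * Real.exp (-‖x‖ ^ 2))
    (fun x => by positivity) ?_ ?_ hg hgm
  · refine (key.comp Real.tendsto_sqrt_atTop).congr' ?_
    filter_upwards [eventually_ge_atTop 0] with s hs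
    simp only [Function.comp_apply]
    rw [← integral_const_mul]
    congr 1 with x
    rw [Real.div_rpow hs Real.pi_pos.le, norm_smul, mul_pow, Real.norm_eq_abs, sq_abs,
      Real.sq_sqrt hs, norm_sub_rev, Real.sqrt_eq_rpow, ← Real.rpow_natCast, ← Real.rpow_mul hs,
      smul_eq_mul, neg_mul, ← hd]
    ring_nf
  · have h := GaussianFourier.integral_rexp_neg_mul_sq_norm (V := E) one_pos
    simp only [neg_mul, one_mul, div_one] at h
    rw [integral_const_mul, h, inv_mul_cancel₀ hpi.ne']
  · have h := (tendsto_norm_pow_mul_exp_neg_norm_sq_cobounded (E := E) d).const_mul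
      (Real.pi ^ ((d : ℝ) / 2))⁻¹
    rw [mul_zero] at h
    exact h.congr fun x => by ring

/-- If a convex set has an interior point over `m`, almost every point of the fibre over `m`
avoids its frontier. -/
lemma Convex.ae_prodMk_notMem_frontier
    {E F : Type*} [NormedAddCommGroup E] [NormedSpace ℝ E]
    [NormedAddCommGroup F] [NormedSpace ℝ F] [FiniteDimensional ℝ F]
    [MeasurableSpace F] [BorelSpace F] (μ : Measure F) [μ.IsAddHaarMeasure]
    {K : Set (E × F)} (hK : Convex ℝ K) (hKc : IsClosed K) {m : E} {y₀ : F}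
    (hm : (m, y₀) ∈ interior K) :
    ∀ᵐ y ∂μ, (m, y) ∉ frontier K := by
  set A : Set F := {y | (m, y) ∈ interior K} with hA
  have hAo : IsOpen A := isOpen_interior.preimage (by fun_prop)
  have hAc : Convex ℝ A := by
    intro x hx y hy a b ha hb hab
    have h := hK.interior hx hy ha hb hab
    simpa [hA, ← add_smul, hab] using h
  rw [ae_iff]
  refine measure_mono_null (fun y hy => ?_) (hAc.addHaar_frontier μ)
  simp only [not_not, Set.mem_ofPred_eq, hKc.frontier_eq] at hy
  rw [hAo.frontier_eq]
  refine ⟨?_, hy.2⟩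
  have hsub : openSegment ℝ y₀ y ⊆ A := by
    rintro _ ⟨a, b, ha, hb, hab, rfl⟩
    have h := hK.openSegment_interior_self_subset_interior hm hy.1 ⟨a, b, ha, hb, hab, rfl⟩
    simpa [hA, ← add_smul, hab] using h
  exact closure_mono hsub (segment_subset_closure_openSegment (right_mem_segment ℝ y₀ y))

/-- Fibre integrals of a continuous function over a compact convex set depend continuously on
the base point, at every base point whose fibre meets the interior. -/
lemma Convex.continuousAt_integral_indicator_prodMk
    {E F : Type*} [NormedAddCommGroup E] [NormedSpace ℝ E]
    [NormedAddCommGroup F] [NormedSpace ℝ F] [FiniteDimensional ℝ F]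
    [MeasurableSpace F] [BorelSpace F] (μ : Measure F) [μ.IsAddHaarMeasure]
    {K : Set (E × F)} (hK : Convex ℝ K) (hKc : IsCompact K) {m : E} {y₀ : F}
    (hm : (m, y₀) ∈ interior K) {f : E × F → ℝ} (hf : Continuous f) :
    ContinuousAt (fun x => ∫ y, K.indicator f (x, y) ∂μ) m := by
  obtain ⟨C, hC⟩ := hKc.exists_bound_of_continuousOn hf.continuousOn
  have hS : IsCompact (Prod.snd '' K) := hKc.image continuous_snd
  refine continuousAt_of_dominated (bound := (Prod.snd '' K).indicator fun _ => C) ?_ ?_ ?_ ?_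
  · refine Filter.Eventually.of_forall fun x => ?_
    have hmeas : MeasurableSet {y : F | (x, y) ∈ K} :=
      (hKc.isClosed.preimage (by fun_prop : Continuous fun y : F => (x, y))).measurableSet
    exact (hf.comp (by fun_prop : Continuous fun y : F => (x, y))).aestronglyMeasurable.indicator
      hmeas
  · refine Filter.Eventually.of_forall fun x => Filter.Eventually.of_forall fun y => ?_
    by_cases h : (x, y) ∈ K
    · rw [Set.indicator_of_mem h, Set.indicator_of_mem (Set.mem_image_of_mem Prod.snd h)]
      exact hC _ h
    · rw [Set.indicator_of_notMem h, norm_zero]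
      refine Set.indicator_nonneg (fun _ hw => ?_) _
      obtain ⟨z, hz, -⟩ := hw
      exact (norm_nonneg _).trans (hC z hz)
  · exact (integrable_indicator_iff hS.measurableSet).2
      (integrableOn_const hS.measure_lt_top.ne)
  · filter_upwards [hK.ae_prodMk_notMem_frontier μ hKc.isClosed hm] with y hy
    exact ContinuousAt.comp (f := fun x => (x, y))
      (hf.continuousOn.continuousAt_indicator hy) (by fun_prop)

/-- Laplace approximation on a compact convex set: if `(m, y₀)` is interior to `K`
and `f` is continuous, then
`(s/π)^{p/2} ∫_K e^{−s‖x−m‖²} f(x,y) dx dy → ∫_{K_m} f(m,y) dy` as `s → +∞`,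
where `K_m = {y : (m,y) ∈ K}` is the slice of `K` over `m`. -/
theorem laplace_approximation_on_compact_convex
    (p q : ℕ) (hp : 0 < p) (hq : 0 < q)
    (K : Set (EuclideanSpace ℝ (Fin p) × EuclideanSpace ℝ (Fin q)))
    (hKcpt : IsCompact K) (hKconv : Convex ℝ K)
    (m : EuclideanSpace ℝ (Fin p)) (y₀ : EuclideanSpace ℝ (Fin q))
    (hm : (m, y₀) ∈ interior K)
    (f : EuclideanSpace ℝ (Fin p) × EuclideanSpace ℝ (Fin q) → ℝ)
    (hf : Continuous f) :
    Filter.Tendsto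
      (fun s : ℝ =>
        ((s / Real.pi) ^ ((p : ℝ) / 2)) *
          ∫ z in K, Real.exp (-s * ‖z.1 - m‖ ^ 2) * f z)
      Filter.atTop
      (nhds (∫ y in {y : EuclideanSpace ℝ (Fin q) | (m, y) ∈ K}, f (m, y))) := by
  have hint : ∀ {h : EuclideanSpace ℝ (Fin p) × EuclideanSpace ℝ (Fin q) → ℝ}, Continuous h →
      Integrable (K.indicator h) (volume.prod volume) := fun hh =>
    (integrable_indicator_iff hKcpt.measurableSet).2 (hh.continuousOn.integrableOn_compact hKcpt)
  have key := tendsto_rpow_mul_integral_exp_neg_mul_norm_sq (hint hf).integral_prod_left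
    (hKconv.continuousAt_integral_indicator_prodMk volume hKcpt hm hf)
  have hmeas : MeasurableSet {y : EuclideanSpace ℝ (Fin q) | (m, y) ∈ K} :=
    (hKcpt.isClosed.preimage (by fun_prop : Continuous fun y => (m, y))).measurableSet
  rw [finrank_euclideanSpace_fin] at key
  rw [← integral_indicator hmeas]
  refine key.congr fun s => ?_
  congr 1
  rw [← integral_indicator hKcpt.measurableSet, Measure.volume_eq_prod,
    integral_prod _ (hint (by fun_prop))]
  congr 1 with x
  rw [← integral_const_mul]
  congr 1 with y
  by_cases h : (x, y) ∈ K <;> simp [h]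
end

section
/- Let p, q be positive natural numbers, let K ⊂ ℝ^p × ℝ^q be a compact convex set, let m ∈ ℝ^p be such that (m, y₀) is an interior point of K for some y₀ ∈ ℝ^q, let f_s : K → ℝ (s ∈ ℝ) and f : K → ℝ be continuous functions such that f_s converges to f uniformly on K as s → +∞. Then lim_{s→+∞} (s/π)^{p/2} ∫_K e^{−s‖x−m‖²} f_s(x, y) dx dy = ∫_{K_m} f(m, y) dy, where K_m = {y ∈ ℝ^q : (m, y) ∈ K}. -/
open MeasureTheory

open Filter Topology Module

section Rescaling

variable {V W : Type*} [NormedAddCommGroup V] [NormedSpace ℝ V] [FiniteDimensional ℝ V]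
  [MeasurableSpace V] [BorelSpace V] [MeasurableSpace W]

/-- Change of variables for an affine dilation of the first factor of a product. -/
theorem integral_prod_comp_add_inv_smul (μ : Measure V) [μ.IsAddHaarMeasure]
    (ν : Measure W) [SFinite ν] (m : V) {R : ℝ} (hR : 0 ≤ R) {h : V × W → ℝ}
    (hh : Integrable h (μ.prod ν))
    (hh' : Integrable (fun z : V × W => h (m + R⁻¹ • z.1, z.2)) (μ.prod ν)) :
    ∫ z, h (m + R⁻¹ • z.1, z.2) ∂(μ.prod ν) = R ^ finrank ℝ V * ∫ z, h z ∂(μ.prod ν) := by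
  rw [integral_prod_symm _ hh', integral_prod_symm _ hh, ← integral_const_mul]
  congr 1 with y
  rw [Measure.integral_comp_inv_smul_of_nonneg μ (fun x => h (m + x, y)) hR, smul_eq_mul,
    integral_add_left_eq_self (fun x => h (x, y)) m]

end Rescaling

/-- For a convex set `K` whose interior meets the slice over `m`, almost every point of that slice
of `K` lies in the interior of `K`. -/
theorem Convex.ae_mk_mem_interior {V W : Type*} [NormedAddCommGroup V] [NormedSpace ℝ V]
    [NormedAddCommGroup W] [NormedSpace ℝ W] [FiniteDimensional ℝ W]
    [MeasurableSpace W] [BorelSpace W] (ν : Measure W) [ν.IsAddHaarMeasure]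
    {K : Set (V × W)} (hK : Convex ℝ K) {m : V} {y₀ : W} (hm : (m, y₀) ∈ interior K) :
    ∀ᵐ y ∂ν, (m, y) ∈ K → (m, y) ∈ interior K := by
  set A : Set W := {y | (m, y) ∈ interior K} with hA
  have hline : ∀ y z : W, ∀ a b : ℝ, a + b = 1 →
      ((m, a • y + b • z) : V × W) = a • (m, y) + b • (m, z) := by
    intro y z a b hab
    simp [← add_smul, hab]
  have hAc : Convex ℝ A := by
    intro y hy z hz a b ha hb hab
    change (m, _) ∈ interior K
    rw [hline y z a b hab]
    exact hK.interior hy hz ha hb hab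
  have hAo : IsOpen A := isOpen_interior.preimage (by fun_prop)
  refine measure_mono_null ?_ (hAc.addHaar_frontier ν)
  intro y hy
  simp only [Set.mem_compl_iff, Set.mem_ofPred_eq, Classical.not_imp] at hy
  rw [hAo.frontier_eq]
  refine ⟨?_, hy.2⟩
  have hseg : openSegment ℝ y₀ y ⊆ A := by
    rintro _ ⟨a, b, ha, hb, hab, rfl⟩
    change (m, _) ∈ interior K
    rw [hline y₀ y a b hab]
    exact hK.combo_interior_self_mem_interior hm hy.1 ha hb.le hab
  exact closure_mono hseg (segment_subset_closure_openSegment (right_mem_segment ℝ y₀ y))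

theorem integrable_rexp_neg_norm_sq (V : Type*) [NormedAddCommGroup V] [InnerProductSpace ℝ V]
    [FiniteDimensional ℝ V] [MeasurableSpace V] [BorelSpace V] :
    Integrable (fun v : V => Real.exp (-‖v‖ ^ 2)) := by
  have h := (GaussianFourier.integrable_cexp_neg_mul_sq_norm_add (V := V) (b := 1)
    (by simp) 0 0).norm
  refine h.congr (Eventually.of_forall fun v => ?_)
  simp [Complex.norm_exp, ← Complex.ofReal_pow]

/-- A uniformly convergent family of functions with bounded limit is eventually bounded. -/
theorem TendstoUniformlyOn.eventually_norm_le {ι α E : Type*} [NormedAddCommGroup E]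
    {F : ι → α → E} {f : α → E} {l : Filter ι} {K : Set α} {C : ℝ}
    (h : TendstoUniformlyOn F f l K) (hC : ∀ z ∈ K, ‖f z‖ ≤ C) :
    ∀ᶠ i in l, ∀ z ∈ K, ‖F i z‖ ≤ C + 1 := by
  filter_upwards [Metric.tendstoUniformlyOn_iff.1 h 1 one_pos] with i hi z hz
  have h₁ := hi z hz
  rw [dist_eq_norm, norm_sub_rev] at h₁
  linarith [norm_le_norm_add_norm_sub' (F i z) (f z), hC z hz]

/-- The Gaussian integral over `K`, after rescaling the first variable by `√s`. -/
theorem tendsto_integral_rexp_mul_indicator_comp {V W : Type*}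
    [NormedAddCommGroup V] [InnerProductSpace ℝ V] [FiniteDimensional ℝ V]
    [MeasurableSpace V] [BorelSpace V]
    [NormedAddCommGroup W] [InnerProductSpace ℝ W] [FiniteDimensional ℝ W]
    [MeasurableSpace W] [BorelSpace W]
    {K : Set (V × W)} (hKc : IsCompact K) (hK : Convex ℝ K) {m : V} {y₀ : W}
    (hm : (m, y₀) ∈ interior K) {F : ℝ → V × W → ℝ} {f : V × W → ℝ}
    (hF : ∀ s, ContinuousOn (F s) K) (hf : ContinuousOn f K)
    (hunif : TendstoUniformlyOn F f atTop K) :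
    (∀ᶠ s in atTop, Integrable (fun z : V × W =>
      Real.exp (-‖z.1‖ ^ 2) * K.indicator (F s) (m + (√s)⁻¹ • z.1, z.2))) ∧
    Tendsto (fun s => ∫ z : V × W,
      Real.exp (-‖z.1‖ ^ 2) * K.indicator (F s) (m + (√s)⁻¹ • z.1, z.2)) atTop
      (𝓝 (∫ z : V × W, Real.exp (-‖z.1‖ ^ 2) * K.indicator f (m, z.2))) := by
  obtain ⟨C, hC⟩ := hKc.exists_bound_of_continuousOn hf
  set S : Set W := Prod.snd '' K
  have hS : IsCompact S := hKc.image continuous_snd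
  have hmeas : ∀ s, AEStronglyMeasurable (fun z : V × W =>
      Real.exp (-‖z.1‖ ^ 2) * K.indicator (F s) (m + (√s)⁻¹ • z.1, z.2)) := by
    intro s
    classical
    have h₁ : Measurable (K.indicator (F s)) := by
      rw [← Set.piecewise_eq_indicator]
      exact (hF s).measurable_piecewise continuousOn_const hKc.measurableSet
    have h₂ : Measurable (fun z : V × W => (m + (√s)⁻¹ • z.1, z.2)) :=
      Continuous.measurable (by fun_prop)
    have h₃ : Measurable (fun z : V × W => Real.exp (-‖z.1‖ ^ 2)) :=
      Continuous.measurable (by fun_prop)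
    exact (h₃.mul (h₁.comp h₂)).aestronglyMeasurable
  have hbound : ∀ᶠ s in atTop, ∀ z : V × W,
      ‖Real.exp (-‖z.1‖ ^ 2) * K.indicator (F s) (m + (√s)⁻¹ • z.1, z.2)‖ ≤
        Real.exp (-‖z.1‖ ^ 2) * S.indicator (fun _ => C + 1) z.2 := by
    filter_upwards [hunif.eventually_norm_le hC] with s hs z
    rw [norm_mul, Real.norm_of_nonneg (Real.exp_pos _).le]
    gcongr
    by_cases hz : (m + (√s)⁻¹ • z.1, z.2) ∈ K
    · have hzS : z.2 ∈ S := ⟨_, hz, rfl⟩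
      rw [Set.indicator_of_mem hz, Set.indicator_of_mem hzS]
      exact hs _ hz
    · rw [Set.indicator_of_notMem hz, norm_zero]
      have : 0 ≤ C := (norm_nonneg _).trans (hC _ (interior_subset hm))
      exact Set.indicator_nonneg (fun _ _ => by linarith) _
  have h_int : Integrable (fun z : V × W =>
      Real.exp (-‖z.1‖ ^ 2) * S.indicator (fun _ => C + 1) z.2) :=
    (integrable_rexp_neg_norm_sq V).mul_prod
      ((integrable_indicator_iff hS.measurableSet).2
        (integrableOn_const hS.measure_lt_top.ne))
  refine ⟨hbound.mono fun s hs => h_int.mono' (hmeas s) (Eventually.of_forall hs),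
    tendsto_integral_filter_of_dominated_convergence _ (Eventually.of_forall hmeas)
      (hbound.mono fun s hs => Eventually.of_forall hs) h_int ?_⟩
  have hae : ∀ᵐ z : V × W, (m, z.2) ∈ K → (m, z.2) ∈ interior K :=
    Measure.quasiMeasurePreserving_snd.ae (hK.ae_mk_mem_interior volume hm)
  filter_upwards [hae] with z hz
  have hlim : Tendsto (fun s : ℝ => (m + (√s)⁻¹ • z.1, z.2)) atTop (𝓝 (m, z.2)) := by
    have h₁ : Tendsto (fun s : ℝ => (√s)⁻¹) atTop (𝓝 0) :=
      tendsto_inv_atTop_zero.comp Real.tendsto_sqrt_atTop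
    have h₂ := ((h₁.smul_const z.1).const_add m).prodMk_nhds
      (tendsto_const_nhds (x := z.2))
    simpa using h₂
  refine Tendsto.const_mul _ ?_
  by_cases hzK : (m, z.2) ∈ K
  · have hev : ∀ᶠ s : ℝ in atTop, (m + (√s)⁻¹ • z.1, z.2) ∈ K :=
      hlim.eventually (mem_interior_iff_mem_nhds.1 (hz hzK))
    rw [Set.indicator_of_mem hzK]
    have h₁ := hunif.tendsto_comp (hf _ hzK) (tendsto_nhdsWithin_iff.2 ⟨hlim, hev⟩)
    refine h₁.congr' (hev.mono fun s hs => ?_)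
    exact (Set.indicator_of_mem hs _).symm
  · rw [Set.indicator_of_notMem hzK]
    refine tendsto_const_nhds.congr' ?_
    filter_upwards [hlim.eventually (hKc.isClosed.isOpen_compl.mem_nhds hzK)] with s hs
    exact (Set.indicator_of_notMem hs _).symm

/-- Laplace approximation on a compact convex set with an `s`-dependent density:
if `F s → f` uniformly on `K` as `s → +∞`, each `F s` and `f` being continuous
on `K`, and `(m, y₀)` is interior to `K`, then
`(s/π)^{p/2} ∫_K e^{−s‖x−m‖²} F s (x,y) dx dy → ∫_{K_m} f(m,y) dy`,
where `K_m = {y : (m,y) ∈ K}`. -/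
theorem laplace_approximation_uniform_family
    (p q : ℕ) (hp : 0 < p) (hq : 0 < q)
    (K : Set (EuclideanSpace ℝ (Fin p) × EuclideanSpace ℝ (Fin q)))
    (hKcpt : IsCompact K) (hKconv : Convex ℝ K)
    (m : EuclideanSpace ℝ (Fin p)) (y₀ : EuclideanSpace ℝ (Fin q))
    (hm : (m, y₀) ∈ interior K)
    (F : ℝ → EuclideanSpace ℝ (Fin p) × EuclideanSpace ℝ (Fin q) → ℝ)
    (f : EuclideanSpace ℝ (Fin p) × EuclideanSpace ℝ (Fin q) → ℝ)
    (hF : ∀ s : ℝ, ContinuousOn (F s) K) (hfc : ContinuousOn f K)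
    (hunif : TendstoUniformlyOn F f Filter.atTop K) :
    Filter.Tendsto
      (fun s : ℝ =>
        ((s / Real.pi) ^ ((p : ℝ) / 2)) *
          ∫ z in K, Real.exp (-s * ‖z.1 - m‖ ^ 2) * F s z)
      Filter.atTop
      (nhds (∫ y in {y : EuclideanSpace ℝ (Fin q) | (m, y) ∈ K}, f (m, y))) := by
  obtain ⟨h_int, hlim⟩ := tendsto_integral_rexp_mul_indicator_comp hKcpt hKconv hm hF hfc hunif
  have hpi : (0 : ℝ) < Real.pi ^ ((p : ℝ) / 2) := Real.rpow_pos_of_pos Real.pi_pos _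
  have hslice : IsClosed {y : EuclideanSpace ℝ (Fin q) | (m, y) ∈ K} :=
    hKcpt.isClosed.preimage (by fun_prop)
  have hval : ∫ z : EuclideanSpace ℝ (Fin p) × EuclideanSpace ℝ (Fin q),
      Real.exp (-‖z.1‖ ^ 2) * K.indicator f (m, z.2) =
      Real.pi ^ ((p : ℝ) / 2) *
        ∫ y in {y : EuclideanSpace ℝ (Fin q) | (m, y) ∈ K}, f (m, y) := by
    have hgauss := GaussianFourier.integral_rexp_neg_mul_sq_norm
      (V := EuclideanSpace ℝ (Fin p)) one_pos
    simp only [neg_mul, one_mul, div_one, finrank_euclideanSpace, Fintype.card_fin] at hgauss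
    rw [Measure.volume_eq_prod, integral_prod_mul
      (fun x : EuclideanSpace ℝ (Fin p) => Real.exp (-‖x‖ ^ 2))
      (fun y : EuclideanSpace ℝ (Fin q) => K.indicator f (m, y)), hgauss,
      ← integral_indicator hslice.measurableSet]
    rfl
  have hmain := hlim.const_mul (Real.pi ^ ((p : ℝ) / 2))⁻¹
  rw [hval, inv_mul_cancel_left₀ hpi.ne'] at hmain
  refine hmain.congr' ?_
  filter_upwards [h_int, eventually_gt_atTop 0] with s hs hs0
  have hsq : √s ^ 2 = s := Real.sq_sqrt hs0.le
  set h : EuclideanSpace ℝ (Fin p) × EuclideanSpace ℝ (Fin q) → ℝ :=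
    K.indicator fun z => Real.exp (-s * ‖z.1 - m‖ ^ 2) * F s z with hh
  have hhcont : ContinuousOn
      (fun z : EuclideanSpace ℝ (Fin p) × EuclideanSpace ℝ (Fin q) =>
        Real.exp (-s * ‖z.1 - m‖ ^ 2) * F s z) K :=
    ContinuousOn.mul (Continuous.continuousOn (by fun_prop)) (hF s)
  have hhint : Integrable h :=
    (integrable_indicator_iff hKcpt.measurableSet).2 (hhcont.integrableOn_compact hKcpt)
  have hcomp : (fun z : EuclideanSpace ℝ (Fin p) × EuclideanSpace ℝ (Fin q) =>
      Real.exp (-‖z.1‖ ^ 2) * K.indicator (F s) (m + (√s)⁻¹ • z.1, z.2)) =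
      fun z => h (m + (√s)⁻¹ • z.1, z.2) := by
    ext z
    by_cases hz : (m + (√s)⁻¹ • z.1, z.2) ∈ K
    · have hexp : -s * ‖m + (√s)⁻¹ • z.1 - m‖ ^ 2 = -‖z.1‖ ^ 2 := by
        rw [add_sub_cancel_left, norm_smul, mul_pow, Real.norm_eq_abs, sq_abs, inv_pow, hsq]
        field_simp
      rw [hh, Set.indicator_of_mem hz, Set.indicator_of_mem hz, hexp]
    · rw [hh, Set.indicator_of_notMem hz, Set.indicator_of_notMem hz, mul_zero]
  rw [hcomp] at hs ⊢
  rw [Measure.volume_eq_prod] at hs hhint ⊢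
  rw [integral_prod_comp_add_inv_smul volume volume m (Real.sqrt_nonneg s) hhint hs,
    ← integral_indicator hKcpt.measurableSet, ← mul_assoc]
  congr 1
  rw [finrank_euclideanSpace, Fintype.card_fin, Real.div_rpow hs0.le Real.pi_pos.le,
    Real.sqrt_eq_rpow, ← Real.rpow_mul_natCast hs0.le, one_div_mul_eq_div]
  field_simp
end

section
/- Let T be a tempered distribution on ℝ² (with coordinates (u, v)) such that T(v·∂φ/∂u − u·∂φ/∂v) = (1/2)·T(φ) for every Schwartz function φ on ℝ². Then T = 0. Equivalently, the angular (rotation-generating) vector field operator L = −v ∂/∂u + u ∂/∂v on tempered distributions has no nonzero solution of L T = (1/2) T. -/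
open SchwartzMap LineDeriv
open scoped ContDiff

lemma hasDerivAt_partial {E G : Type*} [NormedAddCommGroup E] [NormedSpace ℝ E]
    [NormedAddCommGroup G] [NormedSpace ℝ G] {F : ℝ × E → G} {t : ℝ} {x : E}
    (hF : DifferentiableAt ℝ F (t, x)) :
    HasDerivAt (fun s => F (s, x)) (fderiv ℝ F (t, x) (1, 0)) t :=
  hF.hasFDerivAt.comp_hasDerivAt t ((hasDerivAt_id t).prodMk (hasDerivAt_const t x))

/-- Differentiation in a real parameter commutes with iterated differentiation in the
remaining variable. -/
lemma hasDerivAt_iteratedFDeriv_partial {E : Type} [NormedAddCommGroup E] [NormedSpace ℝ E]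
    (n : ℕ) {G : Type} [NormedAddCommGroup G] [NormedSpace ℝ G] {F : ℝ × E → G}
    (hF : ContDiff ℝ ∞ F) (t : ℝ) (x : E) :
    HasDerivAt (fun s => iteratedFDeriv ℝ n (fun y => F (s, y)) x)
      (iteratedFDeriv ℝ n (fun y => fderiv ℝ F (t, y) (1, 0)) x) t := by
  induction n generalizing G with
  | zero =>
    exact (continuousMultilinearCurryFin0 ℝ E G).symm.toContinuousLinearEquiv
      |>.toContinuousLinearMap.hasFDerivAt.comp_hasDerivAt t
        (hasDerivAt_partial (hF.differentiable (by simp) (t, x)))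
  | succ n ih =>
    have hdF : ContDiff ℝ ∞ (fderiv ℝ F) := hF.fderiv_right (by simp)
    have hd : Differentiable ℝ (fderiv ℝ F) := hdF.differentiable (by simp)
    set F' : ℝ × E → E →L[ℝ] G := fun p => (fderiv ℝ F p).comp (.inr ℝ ℝ E) with hF'
    have hF_smooth : ContDiff ℝ ∞ F' := hdF.clm_comp contDiff_const
    have hslice (s : ℝ) (y : E) : HasFDerivAt (fun y : E => (s, y)) (.inr ℝ ℝ E) y :=
      hasFDerivAt_prodMk_right s y
    have h₁ (s : ℝ) : (fun y => fderiv ℝ (fun y => F (s, y)) y) = fun y => F' (s, y) := by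
      ext1 y
      exact ((hF.differentiable (by simp) (s, y)).hasFDerivAt.comp y (hslice s y)).fderiv
    have h₂ : (fun y => fderiv ℝ (fun y => fderiv ℝ F (t, y) (1, 0)) y) =
        fun y => fderiv ℝ F' (t, y) (1, 0) := by
      ext y w
      have hl := (((hd (t, y)).hasFDerivAt.comp y (hslice t y)).clm_apply
        (hasFDerivAt_const ((1 : ℝ), (0 : E)) y)).fderiv
      have hr := ((hd (t, y)).hasFDerivAt.clm_comp
        (hasFDerivAt_const (ContinuousLinearMap.inr ℝ ℝ E) (t, y))).fderiv
      have hsymm := (hF.contDiffAt (x := (t, y))).isSymmSndFDerivAt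
        (by simpa using WithTop.coe_le_coe.2 (le_top : (2 : ℕ∞) ≤ ⊤)) (0, w) (1, 0)
      simp only [Function.comp_def] at hl
      rw [hl, hF', hr]
      simpa using hsymm
    simp only [iteratedFDeriv_succ_eq_comp_right, Function.comp_apply, h₁, h₂]
    exact (continuousMultilinearCurryRightEquiv' ℝ n E G).symm.toContinuousLinearEquiv
      |>.toContinuousLinearMap.hasFDerivAt.comp_hasDerivAt t (ih hF_smooth)

/-- First-order Taylor estimate for a curve with bounded second derivative. -/
lemma norm_sub_sub_smul_le_of_hasDerivAt_two {G : Type*} [NormedAddCommGroup G]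
    [NormedSpace ℝ G] {f f' f'' : ℝ → G} {M : ℝ} (hf : ∀ t, HasDerivAt f (f' t) t)
    (hf' : ∀ t, HasDerivAt f' (f'' t) t) (hM : ∀ t, ‖f'' t‖ ≤ M) (a b : ℝ) :
    ‖f b - f a - (b - a) • f' a‖ ≤ M * (b - a) ^ 2 := by
  have hM0 : 0 ≤ M := (norm_nonneg _).trans (hM 0)
  have h₁ (s : ℝ) : ‖f' s - f' a‖ ≤ M * ‖s - a‖ :=
    convex_univ.norm_image_sub_le_of_norm_hasDerivWithin_le
      (fun t _ => (hf' t).hasDerivWithinAt) (fun t _ => hM t) (Set.mem_univ _) (Set.mem_univ _)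
  have h₂ := (convex_uIcc a b).norm_image_sub_le_of_norm_hasDerivWithin_le
    (f := fun s => f s - s • f' a) (f' := fun s => f' s - f' a) (C := M * |b - a|)
    (fun s _ => (((hf s).sub ((hasDerivAt_id s).smul_const (f' a))).congr_deriv
      (by rw [one_smul])).hasDerivWithinAt)
    (fun s hs => (h₁ s).trans
      (mul_le_mul_of_nonneg_left (Set.abs_sub_left_of_mem_uIcc hs) hM0))
    Set.left_mem_uIcc Set.right_mem_uIcc
  calc ‖f b - f a - (b - a) • f' a‖ = ‖f b - b • f' a - (f a - a • f' a)‖ := by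
        congr 1; module
    _ ≤ M * |b - a| * ‖b - a‖ := h₂
    _ = M * (b - a) ^ 2 := by rw [Real.norm_eq_abs, mul_assoc, ← sq, sq_abs]

/-- The clockwise rotation of the plane by the angle `t`, as a continuous linear map. -/
noncomputable def planeRotationMap (t : ℝ) : ℝ × ℝ →L[ℝ] ℝ × ℝ :=
  (Real.cos t • ContinuousLinearMap.fst ℝ ℝ ℝ + Real.sin t • ContinuousLinearMap.snd ℝ ℝ ℝ).prod
    (-Real.sin t • ContinuousLinearMap.fst ℝ ℝ ℝ + Real.cos t • ContinuousLinearMap.snd ℝ ℝ ℝ)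

lemma planeRotationMap_apply (t : ℝ) (z : ℝ × ℝ) : planeRotationMap t z =
    (Real.cos t * z.1 + Real.sin t * z.2, -Real.sin t * z.1 + Real.cos t * z.2) := rfl

lemma planeRotationMap_neg_apply (t : ℝ) (z : ℝ × ℝ) :
    planeRotationMap (-t) (planeRotationMap t z) = z := by
  have := Real.sin_sq_add_cos_sq t
  ext <;> simp only [planeRotationMap_apply, Real.cos_neg, Real.sin_neg]
  · linear_combination z.1 * this
  · linear_combination z.2 * this

lemma norm_planeRotationMap_le (t : ℝ) : ‖planeRotationMap t‖ ≤ 2 := by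
  refine ContinuousLinearMap.opNorm_le_bound _ (by norm_num) fun z => ?_
  have h₁ : |z.1| ≤ ‖z‖ := norm_fst_le z
  have h₂ : |z.2| ≤ ‖z‖ := norm_snd_le z
  have key (a b : ℝ) (ha : |a| ≤ 1) (hb : |b| ≤ 1) : ‖a * z.1 + b * z.2‖ ≤ 2 * ‖z‖ := by
    calc ‖a * z.1 + b * z.2‖ ≤ |a| * |z.1| + |b| * |z.2| := by
          rw [← abs_mul, ← abs_mul]; exact abs_add_le _ _
      _ ≤ 1 * ‖z‖ + 1 * ‖z‖ := by gcongr
      _ = 2 * ‖z‖ := by ring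
  rw [planeRotationMap_apply, norm_prod_le_iff]
  exact ⟨key _ _ (Real.abs_cos_le_one t) (Real.abs_sin_le_one t),
    key _ _ (by simpa using Real.abs_sin_le_one t) (Real.abs_cos_le_one t)⟩

/-- The clockwise rotation of the plane by the angle `t`. -/
noncomputable def planeRotation (t : ℝ) : (ℝ × ℝ) ≃L[ℝ] ℝ × ℝ :=
  .equivOfInverse (planeRotationMap t) (planeRotationMap (-t)) (planeRotationMap_neg_apply t)
    fun z => by simpa using planeRotationMap_neg_apply (-t) z

/-- Pullback of Schwartz functions along the rotation by the angle `t`. -/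
noncomputable def rotatePullback (t : ℝ) : 𝓢(ℝ × ℝ, ℝ) →L[ℝ] 𝓢(ℝ × ℝ, ℝ) :=
  compCLMOfContinuousLinearEquiv ℝ (planeRotation t)

lemma rotatePullback_apply (t : ℝ) (φ : 𝓢(ℝ × ℝ, ℝ)) (z : ℝ × ℝ) :
    rotatePullback t φ z = φ (planeRotationMap t z) := rfl

lemma coe_rotatePullback (t : ℝ) (φ : 𝓢(ℝ × ℝ, ℝ)) :
    ⇑(rotatePullback t φ) = φ ∘ planeRotationMap t := rfl

/-- The vector field `v ∂/∂u − u ∂/∂v` acting on Schwartz functions. -/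
noncomputable def angularDeriv (φ : 𝓢(ℝ × ℝ, ℝ)) : 𝓢(ℝ × ℝ, ℝ) :=
  smulLeftCLM ℝ (fun z : ℝ × ℝ => z.2) (∂_{((1 : ℝ), (0 : ℝ))} φ) -
    smulLeftCLM ℝ (fun z : ℝ × ℝ => z.1) (∂_{((0 : ℝ), (1 : ℝ))} φ)

lemma angularDeriv_apply (φ : 𝓢(ℝ × ℝ, ℝ)) (z : ℝ × ℝ) : angularDeriv φ z =
    z.2 * fderiv ℝ φ z (1, 0) - z.1 * fderiv ℝ φ z (0, 1) := by
  have h₁ : Function.HasTemperateGrowth (fun z : ℝ × ℝ => z.1) :=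
    (ContinuousLinearMap.fst ℝ ℝ ℝ).hasTemperateGrowth
  have h₂ : Function.HasTemperateGrowth (fun z : ℝ × ℝ => z.2) :=
    (ContinuousLinearMap.snd ℝ ℝ ℝ).hasTemperateGrowth
  rw [angularDeriv, sub_apply, smulLeftCLM_apply_apply h₂, smulLeftCLM_apply_apply h₁]
  rfl

lemma angularDeriv_eq_fderiv (φ : 𝓢(ℝ × ℝ, ℝ)) (z : ℝ × ℝ) :
    angularDeriv φ z = fderiv ℝ φ z (z.2, -z.1) := by
  have : ((z.2, -z.1) : ℝ × ℝ) = z.2 • ((1 : ℝ), (0 : ℝ)) - z.1 • ((0 : ℝ), (1 : ℝ)) := by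
    ext <;> simp
  rw [angularDeriv_apply, this, map_sub, map_smul, map_smul, smul_eq_mul, smul_eq_mul]

lemma rotatePullback_angularDeriv (t : ℝ) (φ : 𝓢(ℝ × ℝ, ℝ)) :
    rotatePullback t (angularDeriv φ) = angularDeriv (rotatePullback t φ) := by
  ext z
  rw [rotatePullback_apply, angularDeriv_eq_fderiv, angularDeriv_eq_fderiv, coe_rotatePullback,
    fderiv_comp _ φ.differentiableAt (planeRotationMap t).differentiableAt,
    ContinuousLinearMap.fderiv, ContinuousLinearMap.comp_apply]
  congr 1
  ext <;> simp only [planeRotationMap_apply] <;> ring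

lemma hasDerivAt_planeRotationMap_apply (t : ℝ) (z : ℝ × ℝ) :
    HasDerivAt (fun s => planeRotationMap s z)
      ((planeRotationMap t z).2, -(planeRotationMap t z).1) t := by
  simp only [planeRotationMap_apply]
  refine HasDerivAt.prodMk ?_ ?_
  · exact ((Real.hasDerivAt_cos t).mul_const z.1).add ((Real.hasDerivAt_sin t).mul_const z.2)
  · exact (((Real.hasDerivAt_sin t).neg.mul_const z.1).add
      ((Real.hasDerivAt_cos t).mul_const z.2)).congr_deriv (by ring)

lemma hasDerivAt_iteratedFDeriv_rotatePullback (n : ℕ) (φ : 𝓢(ℝ × ℝ, ℝ)) (t : ℝ)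
    (x : ℝ × ℝ) :
    HasDerivAt (fun s => iteratedFDeriv ℝ n (rotatePullback s φ) x)
      (iteratedFDeriv ℝ n (rotatePullback t (angularDeriv φ)) x) t := by
  set F : ℝ × (ℝ × ℝ) → ℝ := fun p => φ (planeRotationMap p.1 p.2)
  have hF : ContDiff ℝ ∞ F := by
    refine (φ.smooth ⊤).comp ?_
    simp only [planeRotationMap_apply]
    fun_prop
  have hderiv : (fun y => fderiv ℝ F (t, y) (1, 0)) = rotatePullback t (angularDeriv φ) := by
    ext1 y
    rw [rotatePullback_apply, angularDeriv_eq_fderiv]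
    exact (hasDerivAt_partial (hF.differentiable (by simp) (t, y))).unique
      (φ.differentiableAt.hasFDerivAt.comp_hasDerivAt t
      (hasDerivAt_planeRotationMap_apply t y))
  have := hasDerivAt_iteratedFDeriv_partial n hF t x
  rwa [hderiv] at this

lemma pow_mul_norm_iteratedFDeriv_rotatePullback_le (k n : ℕ) (φ : 𝓢(ℝ × ℝ, ℝ)) (t : ℝ)
    (x : ℝ × ℝ) : ‖x‖ ^ k * ‖iteratedFDeriv ℝ n (rotatePullback t φ) x‖ ≤
      2 ^ k * 2 ^ n * SchwartzMap.seminorm ℝ k n φ := by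
  have h₁ : ‖x‖ ≤ 2 * ‖planeRotationMap t x‖ := by
    calc ‖x‖ = ‖planeRotationMap (-t) (planeRotationMap t x)‖ := by
          rw [planeRotationMap_neg_apply]
      _ ≤ 2 * ‖planeRotationMap t x‖ :=
          (planeRotationMap (-t)).le_of_opNorm_le (norm_planeRotationMap_le _) _
  have h₂ : ‖iteratedFDeriv ℝ n (rotatePullback t φ) x‖ ≤
      ‖iteratedFDeriv ℝ n φ (planeRotationMap t x)‖ * 2 ^ n := by
    rw [coe_rotatePullback,
      (planeRotationMap t).iteratedFDeriv_comp_right (φ.smooth n) x le_rfl]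
    refine (ContinuousMultilinearMap.norm_compContinuousLinearMap_le _ _).trans ?_
    rw [Finset.prod_const, Finset.card_univ, Fintype.card_fin]
    gcongr
    exact norm_planeRotationMap_le t
  calc ‖x‖ ^ k * ‖iteratedFDeriv ℝ n (rotatePullback t φ) x‖
      ≤ (2 * ‖planeRotationMap t x‖) ^ k *
          (‖iteratedFDeriv ℝ n φ (planeRotationMap t x)‖ * 2 ^ n) := by gcongr
    _ = 2 ^ k * 2 ^ n * (‖planeRotationMap t x‖ ^ k *
          ‖iteratedFDeriv ℝ n φ (planeRotationMap t x)‖) := by ring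
    _ ≤ _ := by
        gcongr
        exact φ.le_seminorm ℝ k n _

lemma seminorm_rotatePullback_sub_sub_le (k n : ℕ) (φ : 𝓢(ℝ × ℝ, ℝ)) (a b : ℝ) :
    SchwartzMap.seminorm ℝ k n (rotatePullback b φ - rotatePullback a φ -
        (b - a) • rotatePullback a (angularDeriv φ)) ≤
      2 ^ k * 2 ^ n * SchwartzMap.seminorm ℝ k n (angularDeriv (angularDeriv φ)) *
        (b - a) ^ 2 := by
  refine seminorm_le_bound ℝ k n _ (by positivity) fun x => ?_
  have hT := norm_sub_sub_smul_le_of_hasDerivAt_two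
    (fun t => (hasDerivAt_iteratedFDeriv_rotatePullback n φ t x).const_smul (‖x‖ ^ k))
    (fun t => (hasDerivAt_iteratedFDeriv_rotatePullback n (angularDeriv φ) t x).const_smul
      (‖x‖ ^ k))
    (fun t => by
      rw [norm_smul, norm_pow, norm_norm]
      exact pow_mul_norm_iteratedFDeriv_rotatePullback_le k n _ t x) a b
  have hsmooth (ψ : 𝓢(ℝ × ℝ, ℝ)) : ContDiffAt ℝ n ψ x := (ψ.smooth n).contDiffAt
  have hD : iteratedFDeriv ℝ n (rotatePullback b φ - rotatePullback a φ -
        (b - a) • rotatePullback a (angularDeriv φ) : 𝓢(ℝ × ℝ, ℝ)) x =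
      iteratedFDeriv ℝ n (rotatePullback b φ) x - iteratedFDeriv ℝ n (rotatePullback a φ) x -
        (b - a) • iteratedFDeriv ℝ n (rotatePullback a (angularDeriv φ)) x := by
    have hsub : ContDiffAt ℝ n (⇑(rotatePullback b φ) - ⇑(rotatePullback a φ)) x :=
      (hsmooth _).sub (hsmooth _)
    have hsmul : ContDiffAt ℝ n ((b - a) • ⇑(rotatePullback a (angularDeriv φ))) x :=
      (hsmooth (rotatePullback a (angularDeriv φ))).const_smul (b - a)
    change iteratedFDeriv ℝ n (⇑(rotatePullback b φ) - ⇑(rotatePullback a φ) -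
      (b - a) • ⇑(rotatePullback a (angularDeriv φ))) x = _
    rw [iteratedFDeriv_sub_apply hsub hsmul,
      iteratedFDeriv_sub_apply (hsmooth _) (hsmooth _),
      iteratedFDeriv_const_smul_apply (hsmooth _)]
  rw [hD]
  convert hT using 1
  rw [Pi.smul_apply, Pi.smul_apply, smul_comm (b - a), ← smul_sub, ← smul_sub, norm_smul, norm_pow, norm_norm]

/-- Rotating a Schwartz function is weakly differentiable in the angle. -/
lemma hasDerivAt_apply_rotatePullback (T : 𝓢(ℝ × ℝ, ℝ) →L[ℝ] ℝ) (φ : 𝓢(ℝ × ℝ, ℝ)) (t : ℝ) :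
    HasDerivAt (fun s => T (rotatePullback s φ)) (T (rotatePullback t (angularDeriv φ))) t := by
  obtain ⟨s, C, -, hC⟩ := Seminorm.bound_of_continuous
    (schwartz_withSeminorms ℝ (ℝ × ℝ) ℝ) ((normSeminorm ℝ ℝ).comp T.toLinearMap)
    (continuous_norm.comp T.continuous)
  set M : ℕ × ℕ → ℝ := fun i => 2 ^ i.1 * 2 ^ i.2 *
    SchwartzMap.seminorm ℝ i.1 i.2 (angularDeriv (angularDeriv φ))
  have hM0 (i : ℕ × ℕ) : 0 ≤ M i := by positivity
  have hbound (b : ℝ) : ‖T (rotatePullback b φ) - T (rotatePullback t φ) -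
      (b - t) • T (rotatePullback t (angularDeriv φ))‖ ≤
      (C * ∑ i ∈ s, M i) * ‖(b - t) ^ 2‖ := by
    rw [← map_smul, ← map_sub, ← map_sub, Real.norm_of_nonneg (sq_nonneg (b - t)), mul_assoc]
    refine (hC _).trans (mul_le_mul_of_nonneg_left ?_ C.2)
    refine Seminorm.finset_sup_apply_le
      (mul_nonneg (Finset.sum_nonneg fun i _ => hM0 i) (sq_nonneg _)) fun i hi => ?_
    refine (seminorm_rotatePullback_sub_sub_le i.1 i.2 φ t b).trans ?_
    gcongr
    exact Finset.single_le_sum (f := M) (fun i _ => hM0 i) hi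
  rw [hasDerivAt_iff_isLittleO]
  refine (Asymptotics.IsBigO.of_bound _ (.of_forall hbound)).trans_isLittleO ?_
  simpa using Asymptotics.isLittleO_pow_sub_sub t one_lt_two

/-- No tempered distribution on `ℝ²` is an eigenvector of eigenvalue `1/2` of the
rotation generator `L = −v ∂/∂u + u ∂/∂v`: if
`T(v·∂φ/∂u − u·∂φ/∂v) = (1/2)·T(φ)` for every Schwartz function `φ`, then `T = 0`. -/
theorem rotation_generator_no_half_eigenvalue
    (T : SchwartzMap (ℝ × ℝ) ℝ →L[ℝ] ℝ)
    (h : ∀ φ ψ : SchwartzMap (ℝ × ℝ) ℝ,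
      (∀ z : ℝ × ℝ,
        ψ z = z.2 * fderiv ℝ φ z (1, 0) - z.1 * fderiv ℝ φ z (0, 1)) →
      T ψ = (1 / 2) * T φ) :
    T = 0 := by
  have hderiv (φ : 𝓢(ℝ × ℝ, ℝ)) (t : ℝ) : HasDerivAt
      (fun s => T (rotatePullback s φ)) (1 / 2 * T (rotatePullback t φ)) t := by
    rw [← h (rotatePullback t φ) (angularDeriv (rotatePullback t φ)) (angularDeriv_apply _),
      ← rotatePullback_angularDeriv]
    exact hasDerivAt_apply_rotatePullback T φ t
  ext φ
  have hconst (t : ℝ) :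
      HasDerivAt (fun s => Real.exp (-s / 2) * T (rotatePullback s φ)) 0 t := by
    exact ((((hasDerivAt_id t).neg.div_const 2).exp).mul (hderiv φ t)).congr_deriv (by ring)
  have heq := is_const_of_deriv_eq_zero (fun t => (hconst t).differentiableAt)
    (fun t => (hconst t).deriv) (2 * Real.pi) 0
  have h₀ : rotatePullback 0 φ = φ := by
    ext z; simp [rotatePullback_apply, planeRotationMap_apply]
  have h₁ : rotatePullback (2 * Real.pi) φ = φ := by
    ext z; simp [rotatePullback_apply, planeRotationMap_apply]
  simp only [h₀, h₁, neg_zero, zero_div, Real.exp_zero, one_mul] at heq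
  have hlt : Real.exp (-(2 * Real.pi) / 2) < 1 :=
    Real.exp_lt_one_iff.2 (by linarith [Real.pi_pos])
  rw [zero_apply]
  by_contra hne
  exact hlt.ne ((mul_eq_right₀ hne).1 heq)
end

section
/- Let α > 0 and define g : {(x₁, x₂) ∈ ℝ² : x₁ > 0, x₂ > 0} → ℝ by g(x₁, x₂) = (1/2)(x₁ log x₁ + x₂ log x₂ + α(x₁ + x₂) log(α(x₁ + x₂))). Let G(x) be the 2×2 Hessian matrix of g at x, and let G^{jk}(x) denote the (j,k)-entry of G(x)⁻¹. Then for all x₁, x₂ > 0, the Abreu scalar curvature S = −(1/2) Σ_{j,k=1}^2 ∂²G^{jk}/∂x_j∂x_k equals 2α / ((α + 1)(x₁ + x₂)). -/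
open Real

/-- Partial derivative of a real-valued function on `ℝ²` in the `i`-th
coordinate direction. -/
noncomputable def pderiv2 (i : Fin 2) (f : (Fin 2 → ℝ) → ℝ) (x : Fin 2 → ℝ) : ℝ :=
  fderiv ℝ f x (Pi.single i 1)

/-- The open positive quadrant of `ℝ²`. -/
def quadrant : Set (Fin 2 → ℝ) := {x | 0 < x 0 ∧ 0 < x 1}

theorem isOpen_quadrant : IsOpen quadrant :=
  (isOpen_lt continuous_const (continuous_apply 0)).inter
    (isOpen_lt continuous_const (continuous_apply 1))

theorem pderiv2_congr {i : Fin 2} {f g : (Fin 2 → ℝ) → ℝ} (h : ∀ y ∈ quadrant, f y = g y)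
    {x : Fin 2 → ℝ} (hx : x ∈ quadrant) : pderiv2 i f x = pderiv2 i g x := by
  have hfg : f =ᶠ[nhds x] g := Filter.eventuallyEq_of_mem (isOpen_quadrant.mem_nhds hx) h
  rw [pderiv2, pderiv2, hfg.fderiv_eq]

/-- `f` is differentiable at `x` with partial derivatives `a` and `b`. -/
def HasGradient (f : (Fin 2 → ℝ) → ℝ) (a b : ℝ) (x : Fin 2 → ℝ) : Prop :=
  HasFDerivAt f (a • ContinuousLinearMap.proj (R := ℝ) (φ := fun _ : Fin 2 => ℝ) 0 +
    b • ContinuousLinearMap.proj (R := ℝ) (φ := fun _ : Fin 2 => ℝ) 1) x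

section HasGradient

variable {f g : (Fin 2 → ℝ) → ℝ} {a b c d : ℝ} {x : Fin 2 → ℝ}

theorem HasGradient.pderiv2_zero (h : HasGradient f a b x) : pderiv2 0 f x = a := by
  rw [pderiv2, HasFDerivAt.fderiv h]
  simp

theorem HasGradient.pderiv2_one (h : HasGradient f a b x) : pderiv2 1 f x = b := by
  rw [pderiv2, HasFDerivAt.fderiv h]
  simp

theorem hasGradient_const (r : ℝ) (x : Fin 2 → ℝ) : HasGradient (fun _ => r) 0 0 x := by
  unfold HasGradient
  convert hasFDerivAt_const r x using 1
  simp

theorem hasGradient_coord_zero (x : Fin 2 → ℝ) : HasGradient (fun y => y 0) 1 0 x := by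
  exact (hasFDerivAt_apply (𝕜 := ℝ) (0 : Fin 2) x).congr_fderiv
    (ContinuousLinearMap.ext fun v => by simp)

theorem hasGradient_coord_one (x : Fin 2 → ℝ) : HasGradient (fun y => y 1) 0 1 x := by
  exact (hasFDerivAt_apply (𝕜 := ℝ) (1 : Fin 2) x).congr_fderiv
    (ContinuousLinearMap.ext fun v => by simp)

theorem HasGradient.add (hf : HasGradient f a b x) (hg : HasGradient g c d x) :
    HasGradient (fun y => f y + g y) (a + c) (b + d) x := by
  exact (HasFDerivAt.fun_add hf hg).congr_fderiv
    (ContinuousLinearMap.ext fun v => by simp; ring)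

theorem HasGradient.mul (hf : HasGradient f a b x) (hg : HasGradient g c d x) :
    HasGradient (fun y => f y * g y) (a * g x + f x * c) (b * g x + f x * d) x := by
  exact (HasFDerivAt.fun_mul hf hg).congr_fderiv
    (ContinuousLinearMap.ext fun v => by simp; ring)

theorem HasGradient.const_mul (hf : HasGradient f a b x) (r : ℝ) :
    HasGradient (fun y => r * f y) (r * a) (r * b) x := by
  simpa using (hasGradient_const r x).mul hf

theorem HasGradient.comp {φ : ℝ → ℝ} {φ' : ℝ} (hφ : HasDerivAt φ φ' (f x))
    (hf : HasGradient f a b x) : HasGradient (fun y => φ (f y)) (φ' * a) (φ' * b) x := by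
  exact (hφ.comp_hasFDerivAt x hf).congr_fderiv
    (ContinuousLinearMap.ext fun v => by simp; ring)

theorem HasGradient.log (hf : HasGradient f a b x) (h : f x ≠ 0) :
    HasGradient (fun y => Real.log (f y)) ((f x)⁻¹ * a) ((f x)⁻¹ * b) x :=
  HasGradient.comp (Real.hasDerivAt_log h) hf

theorem HasGradient.div (hf : HasGradient f a b x) (hg : HasGradient g c d x) (h : g x ≠ 0) :
    HasGradient (fun y => f y / g y) ((a * g x - f x * c) / g x ^ 2)
      ((b * g x - f x * d) / g x ^ 2) x := by
  have := hf.mul (HasGradient.comp (hasDerivAt_inv h) hg)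
  convert this using 1 <;> field_simp <;> ring

theorem hasGradient_sum (x : Fin 2 → ℝ) : HasGradient (fun y => y 0 + y 1) 1 1 x := by
  simpa using (hasGradient_coord_zero x).add (hasGradient_coord_one x)

theorem hasGradient_parallel (hx : x ∈ quadrant) :
    HasGradient (fun y => y 0 * y 1 / (y 0 + y 1)) (x 1 ^ 2 / (x 0 + x 1) ^ 2)
      (x 0 ^ 2 / (x 0 + x 1) ^ 2) x := by
  have hs : x 0 + x 1 ≠ 0 := (add_pos hx.1 hx.2).ne'
  convert ((hasGradient_coord_zero x).mul (hasGradient_coord_one x)).div (hasGradient_sum x) hs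
    using 1 <;> ring

theorem hasGradient_parallel_fst (hx : x ∈ quadrant) :
    HasGradient (fun y => y 1 ^ 2 / (y 0 + y 1) ^ 2) (-2 * x 1 ^ 2 / (x 0 + x 1) ^ 3)
      (2 * x 0 * x 1 / (x 0 + x 1) ^ 3) x := by
  have hs : x 0 + x 1 ≠ 0 := (add_pos hx.1 hx.2).ne'
  have hq := (hasGradient_coord_one x).div (hasGradient_sum x) hs
  convert hq.mul hq using 1
  · ext y; rw [← sq, div_pow]
  all_goals field_simp; ring

theorem hasGradient_parallel_snd (hx : x ∈ quadrant) :
    HasGradient (fun y => y 0 ^ 2 / (y 0 + y 1) ^ 2) (2 * x 0 * x 1 / (x 0 + x 1) ^ 3)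
      (-2 * x 0 ^ 2 / (x 0 + x 1) ^ 3) x := by
  have hs : x 0 + x 1 ≠ 0 := (add_pos hx.1 hx.2).ne'
  have hq := (hasGradient_coord_zero x).div (hasGradient_sum x) hs
  convert hq.mul hq using 1
  · ext y; rw [← sq, div_pow]
  all_goals field_simp; ring

end HasGradient

theorem hasGradient_reducedPotential {α : ℝ} (hα : 0 < α) {x : Fin 2 → ℝ} (hx : x ∈ quadrant) :
    HasGradient (fun v => (1 / 2) * (v 0 * log (v 0) + v 1 * log (v 1) +
        α * (v 0 + v 1) * log (α * (v 0 + v 1))))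
      ((1 / 2) * (log (x 0) + α * log (α * (x 0 + x 1)) + (1 + α)))
      ((1 / 2) * (log (x 1) + α * log (α * (x 0 + x 1)) + (1 + α))) x := by
  have h0 := hx.1.ne'
  have h1 := hx.2.ne'
  have hs : x 0 + x 1 ≠ 0 := (add_pos hx.1 hx.2).ne'
  have hαs := (hasGradient_sum x).const_mul α
  convert ((((hasGradient_coord_zero x).mul ((hasGradient_coord_zero x).log h0)).add
    ((hasGradient_coord_one x).mul ((hasGradient_coord_one x).log h1))).add
    (hαs.mul (hαs.log (mul_ne_zero hα.ne' hs)))).const_mul (1 / 2) using 1 <;>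
  · field_simp
    ring

theorem hessian_reducedPotential {α : ℝ} (hα : 0 < α) {x : Fin 2 → ℝ} (hx : x ∈ quadrant) :
    (Matrix.of fun i i' : Fin 2 => pderiv2 i (fun u => pderiv2 i' (fun v =>
        (1 / 2) * (v 0 * log (v 0) + v 1 * log (v 1) +
          α * (v 0 + v 1) * log (α * (v 0 + v 1)))) u) x) =
      !![(1 / 2) * (1 / x 0 + α / (x 0 + x 1)), (1 / 2) * (α / (x 0 + x 1));
        (1 / 2) * (α / (x 0 + x 1)), (1 / 2) * (1 / x 1 + α / (x 0 + x 1))] := by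
  have hs : x 0 + x 1 ≠ 0 := (add_pos hx.1 hx.2).ne'
  have hlog := (((hasGradient_sum x).const_mul α).log (mul_ne_zero hα.ne' hs)).const_mul α
  have hg0 := ((((hasGradient_coord_zero x).log hx.1.ne').add hlog).add
    (hasGradient_const (1 + α) x)).const_mul (1 / 2)
  have hg1 := ((((hasGradient_coord_one x).log hx.2.ne').add hlog).add
    (hasGradient_const (1 + α) x)).const_mul (1 / 2)
  have e0 (i : Fin 2) := pderiv2_congr (i := i)
    (fun y hy => (hasGradient_reducedPotential hα hy).pderiv2_zero) hx
  have e1 (i : Fin 2) := pderiv2_congr (i := i)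
    (fun y hy => (hasGradient_reducedPotential hα hy).pderiv2_one) hx
  ext i j
  fin_cases i <;> fin_cases j
  · refine (e0 0).trans (hg0.pderiv2_zero.trans ?_)
    simp; field_simp
  · refine (e1 0).trans (hg1.pderiv2_zero.trans ?_)
    simp; field_simp
  · refine (e0 1).trans (hg0.pderiv2_one.trans ?_)
    simp; field_simp
  · refine (e1 1).trans (hg1.pderiv2_one.trans ?_)
    simp; field_simp

theorem inv_hessian_reducedPotential {α : ℝ} (hα : 0 < α) {x : Fin 2 → ℝ}
    (hx : x ∈ quadrant) :
    (Matrix.of fun i i' : Fin 2 => pderiv2 i (fun u => pderiv2 i' (fun v =>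
        (1 / 2) * (v 0 * log (v 0) + v 1 * log (v 1) +
          α * (v 0 + v 1) * log (α * (v 0 + v 1)))) u) x)⁻¹ =
      !![2 / (1 + α) * (x 0 + α * (x 0 * x 1 / (x 0 + x 1))),
          2 / (1 + α) * (-α * (x 0 * x 1 / (x 0 + x 1)));
        2 / (1 + α) * (-α * (x 0 * x 1 / (x 0 + x 1))),
          2 / (1 + α) * (x 1 + α * (x 0 * x 1 / (x 0 + x 1)))] := by
  have h0 := hx.1.ne'
  have h1 := hx.2.ne'
  have hs : x 0 + x 1 ≠ 0 := (add_pos hx.1 hx.2).ne'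
  have hα' : 1 + α ≠ 0 := by positivity
  rw [hessian_reducedPotential hα hx]
  apply Matrix.inv_eq_right_inv
  rw [Matrix.mul_fin_two, Matrix.one_fin_two]
  ext i j
  fin_cases i <;> fin_cases j <;> simp <;> field_simp <;> ring

/-- For the reduced symplectic potential
`g(x₁,x₂) = (1/2)(x₁ log x₁ + x₂ log x₂ + α(x₁+x₂) log(α(x₁+x₂)))` on the
quadrant `x₁, x₂ > 0`, with Hessian matrix `G` and inverse entries `G^{jk}`,
Abreu's scalar curvature `S = −(1/2) Σ_{j,k} ∂²G^{jk}/∂x_j∂x_k` equals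
`2α/((α+1)(x₁+x₂))`. -/
theorem abreu_scalar_curvature_reduced_potential (α : ℝ) (hα : 0 < α) :
    ∀ x : Fin 2 → ℝ, 0 < x 0 → 0 < x 1 →
      (-(1 / 2)) *
          ∑ j : Fin 2, ∑ k : Fin 2,
            pderiv2 j
              (fun y =>
                pderiv2 k
                  (fun z =>
                    ((Matrix.of fun i i' : Fin 2 =>
                      pderiv2 i
                        (fun u =>
                          pderiv2 i'
                            (fun v =>
                              (1 / 2) * (v 0 * log (v 0) + v 1 * log (v 1) +
                                α * (v 0 + v 1) * log (α * (v 0 + v 1))))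
                            u)
                        z)⁻¹) j k)
                  y)
              x
        = 2 * α / ((α + 1) * (x 0 + x 1)) := by
  intro x h0 h1
  have hx : x ∈ quadrant := ⟨h0, h1⟩
  have hs : x 0 + x 1 ≠ 0 := by positivity
  have hα' : 1 + α ≠ 0 := by positivity
  have key : ∀ j k : Fin 2, _ := fun j k =>
    pderiv2_congr (i := j) (fun y hy => pderiv2_congr (i := k)
      (fun z hz => congrFun (congrFun (inv_hessian_reducedPotential hα hz) j) k) hy) hx
  simp only [key]
  have h00 : pderiv2 0 (fun y => pderiv2 0 (fun z =>
      2 / (1 + α) * (z 0 + α * (z 0 * z 1 / (z 0 + z 1)))) y) x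
      = 2 / (1 + α) * (α * (-2 * x 1 ^ 2 / (x 0 + x 1) ^ 3)) := by
    rw [pderiv2_congr (fun y hy => (((hasGradient_coord_zero y).add
      ((hasGradient_parallel hy).const_mul α)).const_mul (2 / (1 + α))).pderiv2_zero) hx]
    rw [((((hasGradient_const 1 x).add
      ((hasGradient_parallel_fst hx).const_mul α)).const_mul (2 / (1 + α))).pderiv2_zero)]
    ring
  have h11 : pderiv2 1 (fun y => pderiv2 1 (fun z =>
      2 / (1 + α) * (z 1 + α * (z 0 * z 1 / (z 0 + z 1)))) y) x
      = 2 / (1 + α) * (α * (-2 * x 0 ^ 2 / (x 0 + x 1) ^ 3)) := by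
    rw [pderiv2_congr (fun y hy => (((hasGradient_coord_one y).add
      ((hasGradient_parallel hy).const_mul α)).const_mul (2 / (1 + α))).pderiv2_one) hx]
    rw [((((hasGradient_const 1 x).add
      ((hasGradient_parallel_snd hx).const_mul α)).const_mul (2 / (1 + α))).pderiv2_one)]
    ring
  have h01 : pderiv2 0 (fun y => pderiv2 1 (fun z =>
      2 / (1 + α) * (-α * (z 0 * z 1 / (z 0 + z 1)))) y) x
      = 2 / (1 + α) * (-α * (2 * x 0 * x 1 / (x 0 + x 1) ^ 3)) := by
    rw [pderiv2_congr (fun y hy => (((hasGradient_parallel hy).const_mul (-α)).const_mul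
      (2 / (1 + α))).pderiv2_one) hx]
    exact (((hasGradient_parallel_snd hx).const_mul (-α)).const_mul (2 / (1 + α))).pderiv2_zero
  have h10 : pderiv2 1 (fun y => pderiv2 0 (fun z =>
      2 / (1 + α) * (-α * (z 0 * z 1 / (z 0 + z 1)))) y) x
      = 2 / (1 + α) * (-α * (2 * x 0 * x 1 / (x 0 + x 1) ^ 3)) := by
    rw [pderiv2_congr (fun y hy => (((hasGradient_parallel hy).const_mul (-α)).const_mul
      (2 / (1 + α))).pderiv2_zero) hx]
    exact (((hasGradient_parallel_fst hx).const_mul (-α)).const_mul (2 / (1 + α))).pderiv2_one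
  simp only [Fin.sum_univ_two, Matrix.of_apply, Matrix.cons_val_zero, Matrix.cons_val_one,
    h00, h01, h10, h11]
  rw [add_comm α 1]
  field_simp
  ring
end
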